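/- Let p be a prime number, let A be a commutative ℕ-graded connected 𝔽_p-algebra which is finite dimensional over 𝔽_p in each degree, and let B be a nonzero commutative 𝔽_p-algebra, regarded as a graded algebra concentrated in degree 0. If the graded B-algebra A ⊗_{𝔽_p} B is a graded polynomial B-algebra of type (d_1, …, d_r) with all d_i > 0, then A is a graded polynomial 𝔽_p-algebra of the same type (d_1, …, d_r). -/

import Mathlib

open TensorProduct

/-- `A` (with grading `𝒜`) is a graded polynomial `k`-algebra of type `d = (d 1, …, d r)`:
there is a `k`-algebra isomorphism from the polynomial algebra `k[x_1, …, x_r]`, graded so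
that `x_i` is homogeneous of degree `d i` (and the scalars in degree `0`), carrying the
homogeneous components onto the components `𝒜 n`. -/
def IsGradedPolynomialOfType (k A : Type) [CommRing k] [CommRing A] [Algebra k A]
    (𝒜 : ℕ → Submodule k A) {r : ℕ} (d : Fin r → ℕ) : Prop :=
  ∃ e : MvPolynomial (Fin r) k ≃ₐ[k] A,
    ∀ n : ℕ,
      (MvPolynomial.weightedHomogeneousSubmodule k d n).map e.toLinearMap = 𝒜 n

/-- The graded algebra `(A, 𝒜)` is connected: the structure map `k → A` is injective and
its image is exactly the degree-zero component. -/
def GradedConnected (k A : Type) [CommRing k] [CommRing A] [Algebra k A]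
    (𝒜 : ℕ → Submodule k A) : Prop :=
  Function.Injective (algebraMap k A) ∧ 𝒜 0 = LinearMap.range (Algebra.linearMap k A)

/-- The span of the products of two elements of positive degrees adding up to `n`. -/
def gradedDecomposables {k A : Type*} [CommRing k] [CommRing A] [Algebra k A]
    (𝒜 : ℕ → Submodule k A) (n : ℕ) : Submodule k A :=
  Submodule.span k {z | ∃ i j, 0 < i ∧ 0 < j ∧ i + j = n ∧ ∃ x ∈ 𝒜 i, ∃ y ∈ 𝒜 j, x * y = z}

section

variable {k A : Type*}

lemma baseChange_mkQ_gradedDecomposables_mul [CommRing k] [CommRing A] [Algebra k A]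
    (𝒜 : ℕ → Submodule k A) (B : Type*) [CommRing B] [Algebra k B] {i j n : ℕ}
    (hi : 0 < i) (hj : 0 < j) (hn : i + j = n) {x y : B ⊗[k] A}
    (hx : x ∈ (𝒜 i).baseChange B) (hy : y ∈ (𝒜 j).baseChange B) :
    (gradedDecomposables 𝒜 n).mkQ.baseChange B (x * y) = 0 := by
  obtain ⟨x, rfl⟩ := hx
  obtain ⟨y, rfl⟩ := hy
  induction x with
  | zero => simp
  | add x x' h h' => rw [map_add, add_mul, map_add, h, h', add_zero]
  | tmul b a =>
    induction y with
    | zero => simp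
    | add y y' h h' => rw [map_add, mul_add, map_add, h, h', add_zero]
    | tmul b' a' =>
      have h : (a : A) * a' ∈ gradedDecomposables 𝒜 n :=
        Submodule.subset_span ⟨i, j, hi, hj, hn, a, a.2, a', a'.2, rfl⟩
      have h' : (gradedDecomposables 𝒜 n).mkQ ((a : A) * a') = 0 := by simpa using h
      simp only [LinearMap.baseChange_tmul, Submodule.subtype_apply,
        Algebra.TensorProduct.tmul_mul_tmul, h', TensorProduct.tmul_zero]

open MvPolynomial in
/-- Modulo decomposables, each positive-degree component of a graded polynomial algebra is
spanned by the variables of that degree. -/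
lemma baseChange_mkQ_gradedDecomposables_mem_span [CommRing k] [CommRing A] [Algebra k A]
    (𝒜 : ℕ → Submodule k A) (B : Type*) [CommRing B] [Algebra k B]
    {r : ℕ} {d : Fin r → ℕ} (hd : ∀ i, 0 < d i)
    (e : MvPolynomial (Fin r) B ≃ₐ[B] B ⊗[k] A)
    (he : ∀ n, (weightedHomogeneousSubmodule B d n).map e.toLinearMap = (𝒜 n).baseChange B)
    {n : ℕ} (hn : 0 < n) {z : B ⊗[k] A} (hz : z ∈ (𝒜 n).baseChange B) :
    (gradedDecomposables 𝒜 n).mkQ.baseChange B z ∈ Submodule.span B (Set.range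
      fun i : {i // d i = n} ↦ (gradedDecomposables 𝒜 n).mkQ.baseChange B (e (X i.1))) := by
  have hmem {m : ℕ} {P : MvPolynomial (Fin r) B} (hP : IsWeightedHomogeneous d P m) :
      e P ∈ (𝒜 m).baseChange B := by
    rw [← he]; exact ⟨P, hP, rfl⟩
  rw [← he] at hz
  obtain ⟨P, hP, rfl⟩ := hz
  rw [← LinearMap.comp_apply, ← Submodule.mem_comap]
  have hP' : IsWeightedHomogeneous d P n := hP
  rw [P.as_sum]
  refine Submodule.sum_mem _ fun s hs ↦ ?_
  have hw : Finsupp.weight d s = n := hP' (mem_support_iff.mp hs)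
  generalize coeff s P = c
  have hs0 : s ≠ 0 := by rintro rfl; simp at hw; omega
  obtain ⟨i, hi⟩ := Finsupp.ne_iff.mp hs0
  obtain ⟨t, rfl⟩ : ∃ t, s = Finsupp.single i 1 + t :=
    ⟨s - Finsupp.single i 1, (add_tsub_cancel_of_le
      (Finsupp.single_le_iff.mpr (Nat.one_le_iff_ne_zero.mpr hi))).symm⟩
  have hmon : monomial (Finsupp.single i 1 + t) c = X i * monomial t c := by
    rw [X, monomial_mul, one_mul]
  have hwt : d i + Finsupp.weight d t = n := by
    simpa [Finsupp.weight_single_index, Finsupp.weight_apply,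
      Finsupp.sum_add_index', add_mul] using hw
  rw [Submodule.mem_comap, LinearMap.comp_apply, hmon]
  by_cases ht : Finsupp.weight d t = 0
  · have ht0 : t = 0 := Finsupp.ext
      ((weightedDegree_eq_zero_iff (nonTorsionWeight_of fun i ↦ (hd i).ne')).mp ht)
    subst ht0
    have hX : X i * monomial 0 c = c • (X i : MvPolynomial (Fin r) B) := by
      rw [mul_comm, smul_eq_C_mul]; rfl
    rw [hX, map_smul, map_smul]
    exact Submodule.smul_mem _ _ (Submodule.subset_span ⟨⟨i, by simpa using hwt⟩, rfl⟩)
  · rw [AlgEquiv.toLinearMap_apply, map_mul, baseChange_mkQ_gradedDecomposables_mul 𝒜 B (hd i)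
      (Nat.pos_of_ne_zero ht) hwt (hmem (isWeightedHomogeneous_X B d i))
      (hmem (isWeightedHomogeneous_monomial d t c rfl))]
    exact zero_mem _

lemma exists_span_range_eq_top_of_finrank_le [Field k] {V ι : Type*} [AddCommGroup V]
    [Module k V] [FiniteDimensional k V] [Fintype ι]
    (h : Module.finrank k V ≤ Fintype.card ι) :
    ∃ f : ι → V, Submodule.span k (Set.range f) = ⊤ := by
  let b := Module.finBasis k V
  obtain ⟨g⟩ : Nonempty (Fin (Module.finrank k V) ↪ ι) :=
    Function.Embedding.nonempty_of_card_le (by simpa using h)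
  refine ⟨Function.extend g b 0, top_le_iff.mp (b.span_eq ▸ Submodule.span_mono ?_)⟩
  rintro _ ⟨i, rfl⟩
  exact ⟨g i, g.injective.extend_apply _ _ _⟩

open MvPolynomial in
lemma finrank_map_mkQ_gradedDecomposables_le [Field k] [CommRing A] [Algebra k A]
    (𝒜 : ℕ → Submodule k A) (B : Type*) [CommRing B] [Algebra k B] [Nontrivial B]
    {r : ℕ} {d : Fin r → ℕ} (hd : ∀ i, 0 < d i)
    (e : MvPolynomial (Fin r) B ≃ₐ[B] B ⊗[k] A)
    (he : ∀ n, (weightedHomogeneousSubmodule B d n).map e.toLinearMap = (𝒜 n).baseChange B)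
    {n : ℕ} (hn : 0 < n) :
    Module.finrank k ((𝒜 n).map (gradedDecomposables 𝒜 n).mkQ) ≤
      Fintype.card {i // d i = n} := by
  set V := (𝒜 n).map (gradedDecomposables 𝒜 n).mkQ
  set g : {i // d i = n} → B ⊗[k] (A ⧸ gradedDecomposables 𝒜 n) :=
    fun i ↦ (gradedDecomposables 𝒜 n).mkQ.baseChange B (e (X i.1))
  have hmem (x : B ⊗[k] V) : V.subtype.baseChange B x ∈ Submodule.span B (Set.range g) := by
    induction x with
    | zero => simp
    | add x y hx hy => rw [map_add]; exact add_mem hx hy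
    | tmul b v =>
      obtain ⟨_, a, ha, rfl⟩ := v
      exact baseChange_mkQ_gradedDecomposables_mem_span 𝒜 B hd e he hn
        (Submodule.tmul_mem_baseChange_of_mem b ha)
  have hinj : Function.Injective (V.subtype.baseChange B) :=
    Module.Flat.lTensor_preserves_injective_linearMap (M := B) V.subtype V.injective_subtype
  have hfin : Module.Finite B (Submodule.span B (Set.range g)) :=
    Module.Finite.span_of_finite B (Set.finite_range g)
  calc Module.finrank k V = Module.finrank B (B ⊗[k] V) := Module.finrank_baseChange.symm
    _ ≤ Module.finrank B (Submodule.span B (Set.range g)) :=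
      LinearMap.finrank_le_finrank_of_injective
        (f := (V.subtype.baseChange B).codRestrict _ hmem)
        fun x y h ↦ hinj (congrArg Subtype.val h)
    _ ≤ Fintype.card {i // d i = n} := finrank_range_le_card g

lemma exists_le_span_sup_gradedDecomposables [Field k] [CommRing A] [Algebra k A]
    (𝒜 : ℕ → Submodule k A) {r : ℕ} {d : Fin r → ℕ} {n : ℕ} [FiniteDimensional k (𝒜 n)]
    (h : Module.finrank k ((𝒜 n).map (gradedDecomposables 𝒜 n).mkQ) ≤
      Fintype.card {i // d i = n}) :
    ∃ f : {i // d i = n} → A, (∀ i, f i ∈ 𝒜 n) ∧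
      𝒜 n ≤ Submodule.span k (Set.range f) ⊔ gradedDecomposables 𝒜 n := by
  obtain ⟨f, hf⟩ := exists_span_range_eq_top_of_finrank_le h
  choose a ha haf using fun i ↦ (f i).2
  refine ⟨a, ha, ?_⟩
  rw [← Submodule.ker_mkQ (gradedDecomposables 𝒜 n), ← Submodule.comap_map_eq,
    ← Submodule.map_le_iff_le_comap, Submodule.map_span, ← Set.range_comp]
  have := congrArg (Submodule.map (Submodule.subtype _)) hf
  rw [Submodule.map_span, ← Set.range_comp, Submodule.map_top, Submodule.range_subtype] at this
  rw [← this]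
  exact Submodule.span_mono (by rintro _ ⟨i, rfl⟩; exact ⟨i, haf i⟩)

open MvPolynomial in
lemma map_aeval_weightedHomogeneousSubmodule_le [CommRing k] [CommRing A] [Algebra k A]
    (𝒜 : ℕ → Submodule k A) [GradedAlgebra 𝒜] {r : ℕ} {d : Fin r → ℕ} {a : Fin r → A}
    (ha : ∀ i, a i ∈ 𝒜 (d i)) (n : ℕ) :
    (weightedHomogeneousSubmodule k d n).map (aeval a).toLinearMap ≤ 𝒜 n := by
  rintro _ ⟨P, hP, rfl⟩
  have hP' : IsWeightedHomogeneous d P n := hP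
  rw [AlgHom.toLinearMap_apply, aeval_def, eval₂_eq']
  refine Submodule.sum_mem _ fun s hs ↦ ?_
  rw [← Algebra.smul_def]
  refine Submodule.smul_mem _ _ ?_
  have := SetLike.prod_mem_graded 𝒜 (fun i ↦ s i • d i) (fun i ↦ a i ^ s i) (F := Finset.univ)
    fun i _ ↦ SetLike.pow_mem_graded (s i) (ha i)
  rwa [← hP' (mem_support_iff.mp hs), Finsupp.weight_apply, Finsupp.sum_fintype _ _ (by simp)]

open MvPolynomial in
lemma le_map_aeval_weightedHomogeneousSubmodule [CommRing k] [CommRing A] [Algebra k A]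
    (𝒜 : ℕ → Submodule k A) {r : ℕ} {d : Fin r → ℕ}
    {a : Fin r → A} (h0 : 𝒜 0 ≤ LinearMap.range (Algebra.linearMap k A))
    (h : ∀ n, 0 < n → 𝒜 n ≤ Submodule.span k (Set.range fun i : {i // d i = n} ↦ a i) ⊔
      gradedDecomposables 𝒜 n) (n : ℕ) :
    𝒜 n ≤ (weightedHomogeneousSubmodule k d n).map (aeval a).toLinearMap := by
  induction n using Nat.strong_induction_on with
  | _ n ih =>
    rcases Nat.eq_zero_or_pos n with rfl | hn
    · refine h0.trans ?_
      rintro _ ⟨c, rfl⟩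
      exact ⟨C c, isWeightedHomogeneous_C d c, by simp⟩
    · refine (h n hn).trans (sup_le (Submodule.span_le.mpr ?_) (Submodule.span_le.mpr ?_))
      · rintro _ ⟨⟨i, rfl⟩, rfl⟩
        exact ⟨X i, isWeightedHomogeneous_X k d i, by simp⟩
      · rintro _ ⟨i, j, hi, hj, rfl, x, hx, y, hy, rfl⟩
        obtain ⟨P, hP, rfl⟩ := ih i (by omega) hx
        obtain ⟨Q, hQ, rfl⟩ := ih j (by omega) hy
        exact ⟨P * Q, IsWeightedHomogeneous.mul hP hQ, by simp⟩

open MvPolynomial in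
lemma finrank_weightedHomogeneousSubmodule (R : Type*) [CommRing R] [Nontrivial R]
    {r : ℕ} {d : Fin r → ℕ} (n : ℕ) :
    Module.finrank R (weightedHomogeneousSubmodule R d n) =
      Nat.card {s : Fin r →₀ ℕ | Finsupp.weight d s = n} := by
  rw [weightedHomogeneousSubmodule_eq_finsupp_supported,
    (AddMonoidAlgebra.supportedEquivFinsupp _).finrank_eq, Module.finrank, rank_finsupp_self]
  simp [Nat.card]

open MvPolynomial in
lemma isGradedPolynomialOfType_of_generators {k A : Type} [Field k] [CommRing A] [Algebra k A]
    (𝒜 : ℕ → Submodule k A) [GradedAlgebra 𝒜] {r : ℕ} {d : Fin r → ℕ} (hd : ∀ i, 0 < d i)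
    {a : Fin r → A}
    (hmap : ∀ n, (weightedHomogeneousSubmodule k d n).map (aeval a).toLinearMap = 𝒜 n)
    (hrank : ∀ n, Module.finrank k (weightedHomogeneousSubmodule k d n) =
      Module.finrank k (𝒜 n)) :
    IsGradedPolynomialOfType k A 𝒜 d := by
  have hinj (n : ℕ) (P) (hP : P ∈ weightedHomogeneousSubmodule k d n)
      (h : aeval a P = 0) : P = 0 := by
    have hfW : FiniteDimensional k (weightedHomogeneousSubmodule k d n) :=
      Module.Finite.iff_fg.mpr (weightedHomogeneousSubmodule_fg k d (fun i ↦ (hd i).ne') n)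
    have hfA : FiniteDimensional k (𝒜 n) := by
      rw [← hmap]; infer_instance
    let F : weightedHomogeneousSubmodule k d n →ₗ[k] 𝒜 n :=
      (aeval a).toLinearMap.restrict fun Q hQ ↦ hmap n ▸ ⟨Q, hQ, rfl⟩
    have hF : Function.Surjective F := by
      rintro ⟨y, hy⟩
      rw [← hmap n] at hy
      obtain ⟨Q, hQ, hQy⟩ := hy
      exact ⟨⟨Q, hQ⟩, Subtype.ext hQy⟩
    have := (LinearMap.injective_iff_surjective_of_finrank_eq_finrank (hrank n)).mpr hF
    exact congrArg Subtype.val (this (a₁ := ⟨P, hP⟩) (a₂ := 0) (by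
      rw [map_zero]; exact Subtype.ext h))
  have hbij : Function.Bijective (aeval a : MvPolynomial (Fin r) k →ₐ[k] A) := by
    constructor
    · rw [injective_iff_map_eq_zero]
      intro P hP
      have hmem (n : ℕ) : aeval a (weightedHomogeneousComponent d n P) ∈ 𝒜 n :=
        hmap n ▸ ⟨_, weightedHomogeneousComponent_mem d P n, rfl⟩
      have hfin := weightedHomogeneousComponent_finsupp (w := d) P
      rw [← sum_weightedHomogeneousComponent d P, finsum_eq_sum _ hfin, map_sum] at hP
      rw [← sum_weightedHomogeneousComponent d P, finsum_eq_sum _ hfin]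
      refine Finset.sum_eq_zero fun n hn ↦ ?_
      refine hinj n _ (weightedHomogeneousComponent_mem d P n) ?_
      exact (iSupIndep_iff_finsetSum_eq_zero_imp_eq_zero 𝒜).mp
        (DirectSum.Decomposition.isInternal 𝒜).submodule_iSupIndep _ _ (fun n _ ↦ hmem n) hP n hn
    · rw [← AlgHom.coe_toLinearMap, ← LinearMap.range_eq_top, ← top_le_iff,
        ← (DirectSum.Decomposition.isInternal 𝒜).submodule_iSup_eq_top]
      exact iSup_le fun n ↦ hmap n ▸ LinearMap.map_le_range
  exact ⟨AlgEquiv.ofBijective _ hbij, hmap⟩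

end

/-- Let `p` be a prime, `A` a commutative `ℕ`-graded connected `𝔽_p`-algebra
which is finite dimensional in each degree, and `B` a nonzero commutative `𝔽_p`-algebra,
concentrated in degree `0`.  If `A ⊗_{𝔽_p} B` (with components `A_n ⊗ B`) is a graded
polynomial `B`-algebra of type `(d 1, …, d r)` with all degrees positive, then `A` is a
graded polynomial `𝔽_p`-algebra of the same type. -/
theorem steenrod_stmt_3 (p : ℕ) [Fact p.Prime]
    (A : Type) [CommRing A] [Algebra (ZMod p) A]
    (𝒜 : ℕ → Submodule (ZMod p) A) [GradedAlgebra 𝒜]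
    (hconn : GradedConnected (ZMod p) A 𝒜)
    (hfin : ∀ n : ℕ, FiniteDimensional (ZMod p) (𝒜 n))
    (B : Type) [CommRing B] [Algebra (ZMod p) B] [Nontrivial B]
    {r : ℕ} (d : Fin r → ℕ) (hd : ∀ i, 0 < d i)
    (hpoly : IsGradedPolynomialOfType B (B ⊗[ZMod p] A)
      (fun n => (𝒜 n).baseChange B) d) :
    IsGradedPolynomialOfType (ZMod p) A 𝒜 d := by
  obtain ⟨e, he⟩ := hpoly
  have hgen (n : ℕ) (hn : 0 < n) := exists_le_span_sup_gradedDecomposables (𝒜 := 𝒜)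
    (finrank_map_mkQ_gradedDecomposables_le 𝒜 B hd e he hn)
  choose f hfmem hf using hgen
  let a : Fin r → A := fun i ↦ f (d i) (hd i) ⟨i, rfl⟩
  have hfa (n : ℕ) (hn : 0 < n) : (fun i : {i // d i = n} ↦ a i) = f n hn := by
    funext ⟨i, hi⟩
    subst hi
    rfl
  refine isGradedPolynomialOfType_of_generators 𝒜 hd (a := a) (fun n ↦ le_antisymm
    (map_aeval_weightedHomogeneousSubmodule_le 𝒜 (fun i ↦ hfmem _ _ _) n)
    (le_map_aeval_weightedHomogeneousSubmodule 𝒜 hconn.2.le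
      (fun n hn ↦ by rw [hfa n hn]; exact hf n hn) n)) fun n ↦ ?_
  have hinj : Function.Injective ((𝒜 n).subtype.baseChange B) :=
    Module.Flat.lTensor_preserves_injective_linearMap (M := B) _ (𝒜 n).injective_subtype
  rw [finrank_weightedHomogeneousSubmodule, ← finrank_weightedHomogeneousSubmodule B,
    ← Module.finrank_baseChange (R := B) (M' := 𝒜 n),
    (LinearEquiv.ofInjective _ hinj).finrank_eq]
  exact (e.toLinearEquiv.submoduleMap _).finrank_eq.trans
    (congrArg (fun S : Submodule B (B ⊗[ZMod p] A) ↦ Module.finrank B S) (he n))
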